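/- arXiv:1912.09355 — 2 statements merged into one kernel-verified Lean document; each statement's English description precedes it below -/
import Mathlib

section
/- For every positive integer f, the number of numerical sets T with f(T) = f and m(A(T)) ≤ f/2 is at most f · 3^(f/2). -/
open Filter Topology Set

/-- A numerical set: a cofinite subset of ℕ containing 0, not all of ℕ. -/
def IsNumericalSet (T : Set ℕ) : Prop :=
  0 ∈ T ∧ Tᶜ.Finite ∧ Tᶜ.Nonempty

/-- A numerical semigroup: a numerical set closed under addition. -/
def IsNumericalSemigroup (S : Set ℕ) : Prop :=
  IsNumericalSet S ∧ ∀ a ∈ S, ∀ b ∈ S, a + b ∈ S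

/-- Frobenius number: the largest element of the complement. -/
noncomputable def frob (T : Set ℕ) : ℕ := sSup Tᶜ

/-- The associated semigroup `A(T) = {t | t + T ⊆ T}`. -/
def AT (T : Set ℕ) : Set ℕ := {t : ℕ | ∀ x ∈ T, t + x ∈ T}

/-- Multiplicity: the smallest positive element. -/
noncomputable def mult (S : Set ℕ) : ℕ := sInf {x | x ∈ S ∧ 0 < x}

/-- `R(S) = f(S) - m(S)` as an integer. -/
noncomputable def RVal (S : Set ℕ) : ℤ := (frob S : ℤ) - (mult S : ℤ)

/-- `P(S)`: the number of numerical sets whose associated semigroup is `S`. -/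
noncomputable def PCount (S : Set ℕ) : ℕ :=
  {T : Set ℕ | IsNumericalSet T ∧ AT T = S}.ncard

/-- The density `μ(S) = P(S) / 2^(f(S)-1)`. -/
noncomputable def density (S : Set ℕ) : ℝ :=
  (PCount S : ℝ) / 2 ^ (frob S - 1)

/-- The numerical semigroup `N(D,f) = {0} ∪ {f - l : l ∈ D} ∪ (f, ∞)`. -/
def NSet (D : Finset ℕ) (f : ℕ) : Set ℕ :=
  {0} ∪ (fun l => f - l) '' (D : Set ℕ) ∪ {x | f < x}

/-- `B(D,f)`: numerical sets `T` with `f(T) = f` and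
`A(T) ∩ [f - Max D, f - 1] = {f - l : l ∈ D}`. -/
def BSet (D : Finset ℕ) (f : ℕ) : Set (Set ℕ) :=
  {T | IsNumericalSet T ∧ frob T = f ∧
    AT T ∩ Set.Icc (f - D.sup id) (f - 1) = (fun l => f - l) '' (D : Set ℕ)}

/-- `A_D = |B(D, 2 Max D + 1)|`. -/
noncomputable def AConst (D : Finset ℕ) : ℕ :=
  (BSet D (2 * D.sup id + 1)).ncard

/-- `B_l(k,f) = {T ∈ B({k},f) : T ∩ [1,l] = ∅}`. -/
def BlSet (l k f : ℕ) : Set (Set ℕ) :=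
  {T | T ∈ BSet {k} f ∧ T ∩ Set.Icc 1 l = ∅}

/-- `C_{l,k}`. -/
noncomputable def CConst (l k : ℕ) : ℕ :=
  if l ≤ k then (BlSet l k (2 * k + 1)).ncard else (BlSet l k (l + k + 1)).ncard

/-- `G_l(f) = {T : A(T) = N_f, T ∩ [1,l] = ∅}`. -/
def GSet (l f : ℕ) : Set (Set ℕ) :=
  {T | IsNumericalSet T ∧ AT T = NSet ∅ f ∧ T ∩ Set.Icc 1 l = ∅}

/-- The sets containing `0` and everything above `f` that are stable under adding `m`. -/
def shiftClosedSets (m f : ℕ) : Set (Set ℕ) :=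
  {T | 0 ∈ T ∧ (∀ x, f < x → x ∈ T) ∧ ∀ x ∈ T, m + x ∈ T}

/-- For each `j < m`, the index of the first element of `T` in the progression
`m - j, 2 * m - j, …`. -/
noncomputable def firstIndex (m : ℕ) (T : Set ℕ) (j : Fin m) : ℕ :=
  sInf {k | m - j + k * m ∈ T}

theorem sub_add_div_mul_mem {m f : ℕ} {T : Set ℕ} (hT : T ∈ shiftClosedSets m f) (j : Fin m) :
    m - j + (f + j) / m * m ∈ T := by
  have hj := j.isLt
  have h := Nat.lt_div_mul_add (a := f + j) (b := m) (by omega)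
  exact hT.2.1 _ (by omega)

theorem firstIndex_le_iff {m f : ℕ} {T : Set ℕ} (hT : T ∈ shiftClosedSets m f) (j : Fin m)
    (k : ℕ) : firstIndex m T j ≤ k ↔ m - j + k * m ∈ T := by
  refine ⟨fun h => ?_, fun h => Nat.sInf_le h⟩
  induction k, h using Nat.le_induction with
  | base => exact Nat.sInf_mem (s := {k | m - j + k * m ∈ T}) ⟨_, sub_add_div_mul_mem hT j⟩
  | succ k _ ih =>
    have := hT.2.2 _ ih
    rwa [show m + (m - j + k * m) = m - j + (k + 1) * m by ring] at this

theorem injOn_firstIndex {m : ℕ} (hm : 0 < m) (f : ℕ) :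
    InjOn (firstIndex m) (shiftClosedSets m f) := by
  intro T hT U hU h
  ext x
  rcases Nat.eq_zero_or_pos x with rfl | hx
  · exact iff_of_true hT.1 hU.1
  · have hlt := Nat.mod_lt (x - 1) hm
    have hdiv := Nat.div_add_mod' (x - 1) m
    let j : Fin m := ⟨m - 1 - (x - 1) % m, by omega⟩
    have hxj : m - j + (x - 1) / m * m = x := by
      change m - (m - 1 - (x - 1) % m) + (x - 1) / m * m = x
      omega
    rw [← hxj, ← firstIndex_le_iff hT, ← firstIndex_le_iff hU, h]

theorem mapsTo_firstIndex (m f : ℕ) :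
    MapsTo (firstIndex m) (shiftClosedSets m f)
      (Fintype.piFinset fun j : Fin m => Finset.range ((f + j) / m + 1)) := by
  intro T hT
  simp only [Finset.mem_coe, Fintype.mem_piFinset, Finset.mem_range, Nat.lt_succ_iff]
  exact fun j => (firstIndex_le_iff hT j _).2 (sub_add_div_mul_mem hT j)

theorem finite_shiftClosedSets {m : ℕ} (hm : 0 < m) (f : ℕ) : (shiftClosedSets m f).Finite :=
  Set.Finite.of_injOn (mapsTo_firstIndex m f) (injOn_firstIndex hm f) (Finset.finite_toSet _)

theorem sum_range_add_div {m : ℕ} (hm : 0 < m) (f : ℕ) :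
    ∑ j ∈ Finset.range m, (f + j) / m = f := by
  induction f with
  | zero =>
    refine Finset.sum_eq_zero fun j hj => ?_
    rw [zero_add, Nat.div_eq_of_lt (Finset.mem_range.1 hj)]
  | succ f ih =>
    have h₁ := Finset.sum_range_succ (fun j => (f + j) / m) m
    have h₂ := Finset.sum_range_succ' (fun j => (f + j) / m) m
    have h₃ := Nat.add_div_right f hm
    simp only [add_zero, ← add_assoc, add_right_comm f _ 1] at h₁ h₂
    omega

theorem succ_sq_le_three_pow {n : ℕ} (hn : 2 ≤ n) : (n + 1) ^ 2 ≤ 3 ^ n := by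
  induction n, hn using Nat.le_induction with
  | base => norm_num
  | succ n hn ih =>
    rw [pow_succ 3]
    nlinarith

theorem ncard_shiftClosedSets_sq_le {m f : ℕ} (hm : 0 < m) (hmf : 2 * m ≤ f) :
    (shiftClosedSets m f).ncard ^ 2 ≤ 3 ^ f := by
  have hcard : (shiftClosedSets m f).ncard ≤ ∏ j : Fin m, ((f + j) / m + 1) := by
    have h := Set.ncard_le_ncard_of_injOn _ (mapsTo_firstIndex m f) (injOn_firstIndex hm f)
      (Finset.finite_toSet _)
    simpa only [Set.ncard_coe_finset, Fintype.card_piFinset, Finset.card_range] using h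
  calc (shiftClosedSets m f).ncard ^ 2
      ≤ (∏ j : Fin m, ((f + j) / m + 1)) ^ 2 := Nat.pow_le_pow_left hcard 2
    _ = ∏ j : Fin m, ((f + j) / m + 1) ^ 2 := (Finset.prod_pow _ _ _).symm
    _ ≤ ∏ j : Fin m, 3 ^ ((f + j) / m) := Finset.prod_le_prod' fun j _ =>
        succ_sq_le_three_pow ((Nat.le_div_iff_mul_le hm).2 (by omega))
    _ = 3 ^ f := by
        rw [Finset.prod_pow_eq_pow_sum, Fin.sum_univ_eq_sum_range (fun j => (f + j) / m),
          sum_range_add_div hm]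

theorem ncard_shiftClosedSets_le {m f : ℕ} (hm : 0 < m) (hmf : 2 * m ≤ f) :
    ((shiftClosedSets m f).ncard : ℝ) ≤ 3 ^ ((f : ℝ) / 2) := by
  refine le_of_sq_le_sq ?_ (by positivity)
  rw [← Real.rpow_mul_natCast (by norm_num), Nat.cast_ofNat, div_mul_cancel₀ _ two_ne_zero,
    Real.rpow_natCast]
  exact_mod_cast ncard_shiftClosedSets_sq_le hm hmf

theorem mem_of_frob_lt {T : Set ℕ} (hT : IsNumericalSet T) {x : ℕ} (hx : frob T < x) :
    x ∈ T := by
  by_contra h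
  exact hx.not_ge (le_csSup hT.2.1.bddAbove h)

theorem mult_AT_mem {T : Set ℕ} (hT : IsNumericalSet T) :
    mult (AT T) ∈ AT T ∧ 0 < mult (AT T) :=
  Nat.sInf_mem (s := {x | x ∈ AT T ∧ 0 < x})
    ⟨frob T + 1, fun _ _ => mem_of_frob_lt hT (by omega), by omega⟩

theorem stmt2 (f : ℕ) (hf : 0 < f) :
    ({T : Set ℕ | IsNumericalSet T ∧ frob T = f ∧
        (mult (AT T) : ℝ) ≤ (f : ℝ) / 2}.ncard : ℝ)
      ≤ (f : ℝ) * 3 ^ ((f : ℝ) / 2) := by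
  have hsub : {T : Set ℕ | IsNumericalSet T ∧ frob T = f ∧ (mult (AT T) : ℝ) ≤ (f : ℝ) / 2} ⊆
      ⋃ m ∈ Finset.Icc 1 (f / 2), shiftClosedSets m f := by
    rintro T ⟨hT, rfl, hle⟩
    obtain ⟨hmem, hpos⟩ := mult_AT_mem hT
    have h : mult (AT T) * 2 ≤ frob T := by
      rw [le_div_iff₀ two_pos] at hle
      exact_mod_cast hle
    simp only [Set.mem_iUnion, Finset.mem_Icc]
    exact ⟨mult (AT T), ⟨hpos, by omega⟩, hT.1, fun _ => mem_of_frob_lt hT, hmem⟩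
  have hfin : (⋃ m ∈ Finset.Icc 1 (f / 2), shiftClosedSets m f).Finite :=
    (Finset.finite_toSet _).biUnion fun m hm =>
      finite_shiftClosedSets (Finset.mem_Icc.1 (Finset.mem_coe.1 hm)).1 f
  have hcard := (Set.ncard_le_ncard hsub hfin).trans (Finset.set_ncard_biUnion_le _ _)
  calc _ ≤ ((∑ m ∈ Finset.Icc 1 (f / 2), (shiftClosedSets m f).ncard : ℕ) : ℝ) :=
        Nat.cast_le.2 hcard
    _ ≤ ∑ m ∈ Finset.Icc 1 (f / 2), (3 : ℝ) ^ ((f : ℝ) / 2) := by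
        rw [Nat.cast_sum]
        refine Finset.sum_le_sum fun m hm => ?_
        rw [Finset.mem_Icc] at hm
        exact ncard_shiftClosedSets_le hm.1 (by omega)
    _ ≤ (f : ℝ) * 3 ^ ((f : ℝ) / 2) := by
        rw [Finset.sum_const, nsmul_eq_mul, Nat.card_Icc, Nat.add_sub_cancel]
        gcongr
        exact Nat.div_le_self f 2
end

section
/- The series Σ_{n=−1}^{∞} α_n converges and equals 1. -/
open Filter Topology Set

/-- The numerical sets with Frobenius number `f`, described by membership conditions. -/
theorem isNumericalSet_and_frob_eq_iff (T : Set ℕ) (f : ℕ) :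
    (IsNumericalSet T ∧ frob T = f) ↔ (0 ∈ T ∧ f ∉ T ∧ ∀ x, f < x → x ∈ T) := by
  constructor
  · rintro ⟨⟨h0, hfin, hne⟩, rfl⟩
    refine ⟨h0, Nat.sSup_mem hne hfin.bddAbove, fun x hx => ?_⟩
    by_contra hxT
    exact absurd (le_csSup hfin.bddAbove hxT) (not_le.mpr hx)
  · rintro ⟨h0, hf, hT⟩
    have hub : ∀ x ∈ Tᶜ, x ≤ f := fun x hx => by
      by_contra h
      exact hx (hT x (by omega))
    exact ⟨⟨h0, (Set.finite_Iic f).subset hub, ⟨f, hf⟩⟩,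
      IsGreatest.csSup_eq ⟨hf, hub⟩⟩

/-- The family of numerical sets with Frobenius number `f`. -/
def numSets (f : ℕ) : Set (Set ℕ) := {T | IsNumericalSet T ∧ frob T = f}

theorem mem_numSets {T : Set ℕ} {f : ℕ} :
    T ∈ numSets f ↔ (0 ∈ T ∧ f ∉ T ∧ ∀ x, f < x → x ∈ T) :=
  isNumericalSet_and_frob_eq_iff T f

theorem numSets_eq_image {f : ℕ} (hf : 1 ≤ f) :
    numSets f = (fun S : Finset ℕ => (S : Set ℕ) ∪ {0} ∪ Set.Ioi f) ''
      ((Finset.Icc 1 (f - 1)).powerset : Set (Finset ℕ)) := by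
  classical
  ext T
  rw [mem_numSets]
  constructor
  · rintro ⟨h0, hfT, hT⟩
    refine ⟨{x ∈ Finset.Icc 1 (f - 1) | x ∈ T},
      Finset.mem_coe.mpr (Finset.mem_powerset.mpr (Finset.filter_subset _ _)), ?_⟩
    ext x
    simp only [Finset.coe_filter, Finset.mem_Icc, Set.mem_union, Set.mem_ofPred_eq,
      Set.mem_singleton_iff, Set.mem_Ioi]
    constructor
    · rintro ((h | rfl) | h)
      exacts [h.2, h0, hT x h]
    · intro hx
      have : x ≠ f := fun h => hfT (h ▸ hx)
      by_cases hx0 : x = 0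
      · exact Or.inl (Or.inr hx0)
      by_cases hxf : f < x
      · exact Or.inr hxf
      exact Or.inl (Or.inl ⟨by omega, hx⟩)
  · rintro ⟨S, hS, rfl⟩
    rw [Finset.mem_coe, Finset.mem_powerset] at hS
    refine ⟨by simp, ?_, fun x hx => Or.inr hx⟩
    rintro ((h | h) | h)
    · have := Finset.mem_Icc.mp (hS h)
      omega
    · have : f = 0 := h
      omega
    · exact lt_irrefl f h

theorem numSets_finite (f : ℕ) : (numSets f).Finite := by
  rcases Nat.eq_zero_or_pos f with rfl | hf
  · refine Set.finite_empty.subset fun T hT => ?_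
    have := mem_numSets.mp hT
    exact this.2.1 this.1
  · rw [numSets_eq_image hf]
    exact (Finset.finite_toSet _).image _

theorem ncard_numSets {f : ℕ} (hf : 1 ≤ f) : (numSets f).ncard = 2 ^ (f - 1) := by
  rw [numSets_eq_image hf, Set.InjOn.ncard_image, Set.ncard_coe_finset, Finset.card_powerset,
    Nat.card_Icc, Nat.add_sub_cancel]
  intro S hS S' hS' h
  rw [Finset.mem_coe, Finset.mem_powerset] at hS hS'
  ext x
  have hx := Set.ext_iff.mp h x
  simp only [Set.mem_union, Finset.mem_coe, Set.mem_singleton_iff, Set.mem_Ioi] at hx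
  have h1 : x ∈ S → 1 ≤ x ∧ x ≤ f - 1 := fun h => Finset.mem_Icc.mp (hS h)
  have h2 : x ∈ S' → 1 ≤ x ∧ x ≤ f - 1 := fun h => Finset.mem_Icc.mp (hS' h)
  constructor
  · intro h
    have := h1 h
    rcases hx.mp (Or.inl (Or.inl h)) with (h | h) | h
    exacts [h, by omega, by omega]
  · intro h
    have := h2 h
    rcases hx.mpr (Or.inl (Or.inl h)) with (h | h) | h
    exacts [h, by omega, by omega]

/-- The subsets of `{0, …, n - 1}` closed under adding `t`, as long as the result is below `n`. -/
def shiftClosed (t n : ℕ) : Finset (Finset ℕ) :=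
  {S ∈ (Finset.range n).powerset | ∀ x ∈ S, x + t < n → x + t ∈ S}

theorem mem_shiftClosed {t n : ℕ} {S : Finset ℕ} :
    S ∈ shiftClosed t n ↔ (∀ x ∈ S, x < n) ∧ ∀ x ∈ S, x + t < n → x + t ∈ S := by
  simp [shiftClosed, Finset.subset_iff]

/-- Adding an element to a shift-closed set whose translate leaves the range keeps it closed. -/
theorem two_mul_card_filter_notMem_le {t m : ℕ} (ht : 0 < t) :
    2 * {S ∈ shiftClosed t (t + m) | m ∉ S}.card ≤ (shiftClosed t (t + m)).card := by
  have hle : {S ∈ shiftClosed t (t + m) | m ∉ S}.card ≤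
      {S ∈ shiftClosed t (t + m) | ¬ m ∉ S}.card := by
    refine Finset.card_le_card_of_injOn (insert m) ?_ ?_
    · intro S hS
      simp only [Finset.coe_filter, Set.mem_ofPred_eq, mem_shiftClosed] at hS ⊢
      obtain ⟨⟨hlt, hcl⟩, -⟩ := hS
      refine ⟨⟨fun x hx => ?_, fun x hx hxt => ?_⟩, by simp⟩
      · rcases Finset.mem_insert.mp hx with rfl | hx
        exacts [by omega, hlt x hx]
      · rcases Finset.mem_insert.mp hx with rfl | hx
        exacts [by omega, Finset.mem_insert_of_mem (hcl x hx hxt)]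
    · intro S hS S' hS' h
      simp only [Finset.coe_filter, Set.mem_ofPred_eq] at hS hS'
      rw [← Finset.erase_insert hS.2, ← Finset.erase_insert hS'.2]
      exact congrArg (fun U => Finset.erase U m) h
  have := Finset.card_filter_add_card_filter_not (s := shiftClosed t (t + m)) (fun S => m ∉ S)
  omega

theorem card_shiftClosed_succ_le (t m : ℕ) :
    (shiftClosed t (t + (m + 1))).card ≤
      (shiftClosed t (t + m)).card + {S ∈ shiftClosed t (t + m) | m ∉ S}.card := by
  rw [← Finset.card_filter_add_card_filter_not (s := shiftClosed t (t + (m + 1)))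
    (fun S => t + m ∈ S)]
  refine add_le_add ?_ ?_
  all_goals
    refine Finset.card_le_card_of_injOn (fun S => S.erase (t + m)) ?_ ?_
  · intro S hS
    simp only [Finset.coe_filter, Set.mem_ofPred_eq, mem_shiftClosed, Finset.mem_coe,
      Finset.mem_erase] at hS ⊢
    obtain ⟨⟨hlt, hcl⟩, -⟩ := hS
    refine ⟨fun x hx => ?_, fun x hx hxt => ⟨by omega, hcl x hx.2 (by omega)⟩⟩
    have := hlt x hx.2
    omega
  · intro S hS S' hS' h
    simp only [Finset.coe_filter, Set.mem_ofPred_eq] at hS hS'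
    rw [← Finset.insert_erase hS.2, ← Finset.insert_erase hS'.2]
    exact congrArg (insert (t + m)) h
  · intro S hS
    simp only [Finset.coe_filter, Set.mem_ofPred_eq, mem_shiftClosed, Finset.mem_erase] at hS ⊢
    obtain ⟨⟨hlt, hcl⟩, hm⟩ := hS
    refine ⟨⟨fun x hx => ?_, fun x hx hxt => ⟨by omega, hcl x hx.2 (by omega)⟩⟩, fun h => ?_⟩
    · have := hlt x hx.2
      omega
    · have := hcl m h.2 (by omega)
      rw [add_comm] at this
      exact hm this
  · intro S hS S' hS' h
    simp only [Finset.coe_filter, Set.mem_ofPred_eq] at hS hS'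
    have h : S.erase (t + m) = S'.erase (t + m) := h
    rwa [Finset.erase_eq_of_notMem hS.2, Finset.erase_eq_of_notMem hS'.2] at h

theorem card_shiftClosed_le {t : ℕ} (ht : 0 < t) (m : ℕ) :
    ((shiftClosed t (t + m)).card : ℝ) ≤ 2 ^ t * (3 / 2) ^ m := by
  induction m with
  | zero =>
    have h : (shiftClosed t t).card ≤ 2 ^ t := by
      refine (Finset.card_filter_le _ _).trans ?_
      rw [Finset.card_powerset, Finset.card_range]
    simpa using (show ((shiftClosed t t).card : ℝ) ≤ 2 ^ t by exact_mod_cast h)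
  | succ m ih =>
    have h1 : ((shiftClosed t (t + (m + 1))).card : ℝ) ≤
        (shiftClosed t (t + m)).card + ({S ∈ shiftClosed t (t + m) | m ∉ S}.card : ℝ) := by
      exact_mod_cast card_shiftClosed_succ_le t m
    have h2 : 2 * ({S ∈ shiftClosed t (t + m) | m ∉ S}.card : ℝ) ≤
        (shiftClosed t (t + m)).card := by
      exact_mod_cast two_mul_card_filter_notMem_le (m := m) ht
    rw [pow_succ]
    linarith

theorem ncard_mem_AT_le (t f : ℕ) :
    {T | T ∈ numSets f ∧ t ∈ AT T}.ncard ≤ (shiftClosed t f).card := by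
  classical
  rw [← Set.ncard_coe_finset]
  refine Set.ncard_le_ncard_of_injOn (fun T => {x ∈ Finset.range f | x ∈ T}) ?_ ?_
    (Finset.finite_toSet _)
  · rintro T ⟨-, ht⟩
    simp only [Finset.mem_coe, mem_shiftClosed, Finset.mem_filter, Finset.mem_range]
    refine ⟨fun x hx => hx.1, fun x hx hxt => ⟨hxt, ?_⟩⟩
    rw [add_comm]
    exact ht x hx.2
  · rintro T ⟨hT, -⟩ T' ⟨hT', -⟩ h
    obtain ⟨-, hf, hgt⟩ := mem_numSets.mp hT
    obtain ⟨-, hf', hgt'⟩ := mem_numSets.mp hT'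
    ext x
    rcases lt_trichotomy x f with hx | rfl | hx
    · have := Finset.ext_iff.mp h x
      simpa [hx] using this
    · exact iff_of_false hf hf'
    · exact iff_of_true (hgt x hx) (hgt' x hx)

theorem AT_mem_numSets {T : Set ℕ} {f : ℕ} (hT : T ∈ numSets f) : AT T ∈ numSets f := by
  obtain ⟨h0, hf, hgt⟩ := mem_numSets.mp hT
  refine mem_numSets.mpr ⟨fun x hx => by rwa [zero_add], fun h => hf (h 0 h0), fun x hx y _ => ?_⟩
  exact hgt _ (by omega)

theorem mult_mem {S : Set ℕ} {f : ℕ} (hS : S ∈ numSets f) : mult S ∈ S ∧ 0 < mult S :=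
  Nat.sInf_mem (s := {x | x ∈ S ∧ 0 < x})
    ⟨f + 1, (mem_numSets.mp hS).2.2 _ (Nat.lt_succ_self f), Nat.succ_pos f⟩

theorem mult_le {S : Set ℕ} {f : ℕ} (hS : S ∈ numSets f) : mult S ≤ f + 1 :=
  Nat.sInf_le ⟨(mem_numSets.mp hS).2.2 _ (Nat.lt_succ_self f), Nat.succ_pos f⟩

theorem sum_two_pow_mul_le (m K : ℕ) :
    ∑ t ∈ Finset.range (m + 1), (2 : ℝ) ^ t * (3 / 2) ^ (m + K - t) ≤
      4 * 2 ^ m * (3 / 2) ^ K := by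
  induction m with
  | zero =>
    have : (0 : ℝ) ≤ (3 / 2) ^ K := by positivity
    simp only [zero_add, Finset.range_one, Finset.sum_singleton, pow_zero, Nat.sub_zero]
    linarith
  | succ m ih =>
    rw [Finset.sum_range_succ]
    have h : ∑ t ∈ Finset.range (m + 1), (2 : ℝ) ^ t * (3 / 2) ^ (m + 1 + K - t) =
        (3 / 2) * ∑ t ∈ Finset.range (m + 1), (2 : ℝ) ^ t * (3 / 2) ^ (m + K - t) := by
      rw [Finset.mul_sum]
      refine Finset.sum_congr rfl fun t ht => ?_
      have := Finset.mem_range.mp ht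
      rw [show m + 1 + K - t = (m + K - t) + 1 by omega, pow_succ]
      ring
    rw [h, show m + 1 + K - (m + 1) = K by omega, pow_succ]
    nlinarith

/-- Few numerical sets have an associated semigroup with multiplicity at most `f - K`. -/
theorem ncard_tail_le (f K : ℕ) :
    ({T | T ∈ numSets f ∧ (K : ℤ) ≤ RVal (AT T)}.ncard : ℝ) ≤ 4 * 2 ^ f * (3 / 4) ^ K := by
  have hmult : ∀ T, T ∈ numSets f ∧ (K : ℤ) ≤ RVal (AT T) → mult (AT T) + K ≤ f := by
    rintro T ⟨hT, hK⟩
    have hfrob : frob (AT T) = f := (AT_mem_numSets hT).2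
    rw [RVal, hfrob] at hK
    omega
  rcases lt_or_ge f K with hfK | hfK
  · have : {T | T ∈ numSets f ∧ (K : ℤ) ≤ RVal (AT T)} = ∅ := by
      refine Set.eq_empty_of_forall_notMem fun T hT => ?_
      have := hmult T hT
      omega
    rw [this, Set.ncard_empty, Nat.cast_zero]
    positivity
  obtain ⟨m, rfl⟩ := Nat.exists_eq_add_of_le' hfK
  have hsub : {T | T ∈ numSets (m + K) ∧ (K : ℤ) ≤ RVal (AT T)} ⊆
      ⋃ t ∈ Finset.Icc 1 m, {T | T ∈ numSets (m + K) ∧ t ∈ AT T} := by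
    intro T hT
    have h1 := hmult T hT
    have h2 := mult_mem (AT_mem_numSets hT.1)
    simp only [Set.mem_iUnion]
    exact ⟨mult (AT T), Finset.mem_Icc.mpr ⟨h2.2, by omega⟩, hT.1, h2.1⟩
  have hfin : (⋃ t ∈ Finset.Icc 1 m, {T | T ∈ numSets (m + K) ∧ t ∈ AT T}).Finite :=
    (numSets_finite (m + K)).subset (Set.iUnion₂_subset fun t _ T hT => hT.1)
  calc ({T | T ∈ numSets (m + K) ∧ (K : ℤ) ≤ RVal (AT T)}.ncard : ℝ)
      ≤ ∑ t ∈ Finset.Icc 1 m, ({T | T ∈ numSets (m + K) ∧ t ∈ AT T}.ncard : ℝ) := by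
        exact_mod_cast (Set.ncard_le_ncard hsub hfin).trans (Finset.set_ncard_biUnion_le _ _)
    _ ≤ ∑ t ∈ Finset.Icc 1 m, (2 : ℝ) ^ t * (3 / 2) ^ (m + K - t) := by
        refine Finset.sum_le_sum fun t ht => ?_
        rw [Finset.mem_Icc] at ht
        have h := card_shiftClosed_le (t := t) (by omega) (m + K - t)
        rw [show t + (m + K - t) = m + K by omega] at h
        exact le_trans (by exact_mod_cast ncard_mem_AT_le t (m + K)) h
    _ ≤ ∑ t ∈ Finset.range (m + 1), (2 : ℝ) ^ t * (3 / 2) ^ (m + K - t) := by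
        refine Finset.sum_le_sum_of_subset_of_nonneg (fun t ht => ?_) fun _ _ _ => by positivity
        rw [Finset.mem_Icc] at ht
        exact Finset.mem_range.mpr (by omega)
    _ ≤ 4 * 2 ^ m * (3 / 2) ^ K := sum_two_pow_mul_le m K
    _ = 4 * 2 ^ (m + K) * (3 / 4) ^ K := by
        rw [pow_add, show (3 / 2 : ℝ) = 2 * (3 / 4) by norm_num, mul_pow]
        ring

theorem ncard_numSets_eq_sum_add (f K : ℕ) :
    (numSets f).ncard =
      ∑ k ∈ Finset.range (K + 1), {T | T ∈ numSets f ∧ RVal (AT T) = (k : ℤ) - 1}.ncard +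
      {T | T ∈ numSets f ∧ (K : ℤ) ≤ RVal (AT T)}.ncard := by
  classical
  have hfin := numSets_finite f
  have hcard : ∀ p : Set ℕ → Prop,
      {T | T ∈ numSets f ∧ p T}.ncard = {T ∈ hfin.toFinset | p T}.card := fun p => by
    rw [← Set.ncard_coe_finset]
    congr 1
    ext T
    simp
  simp only [hcard]
  rw [Set.ncard_eq_toFinset_card _ hfin,
    ← Finset.card_filter_add_card_filter_not (s := hfin.toFinset)
      (fun T => ¬ (K : ℤ) ≤ RVal (AT T))]
  simp only [not_not]
  congr 1
  rw [Finset.card_eq_sum_card_fiberwise (f := fun T => (RVal (AT T) + 1).toNat)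
    (t := Finset.range (K + 1))]
  · refine Finset.sum_congr rfl fun k hk => ?_
    rw [Finset.mem_range] at hk
    congr 1
    ext T
    simp only [Finset.mem_filter, Set.Finite.mem_toFinset, and_assoc]
    refine and_congr_right fun hT => ?_
    have h1 := mult_le (AT_mem_numSets hT)
    have hfrob : frob (AT T) = f := (AT_mem_numSets hT).2
    rw [RVal, hfrob]
    omega
  · intro T hT
    simp only [Finset.coe_filter, Set.mem_ofPred_eq] at hT
    simp only [Finset.mem_coe, Finset.mem_range]
    omega
  · congr

theorem stmt14 (α : ℤ → ℝ)
    (hα : ∀ n : ℤ, -1 ≤ n →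
      Tendsto (fun f : ℕ =>
        (({T : Set ℕ | IsNumericalSet T ∧ frob T = f ∧ RVal (AT T) = n}.ncard : ℝ))
          / 2 ^ (f - 1))
        atTop (nhds (α n))) :
    HasSum (fun k : ℕ => α ((k : ℤ) - 1)) 1 := by
  have hmem : ∀ (f : ℕ) (n : ℤ), {T : Set ℕ | IsNumericalSet T ∧ frob T = f ∧ RVal (AT T) = n} =
      {T | T ∈ numSets f ∧ RVal (AT T) = n} := fun f n => by
    ext T
    simp only [numSets, Set.mem_ofPred_eq, and_assoc]
  simp only [hmem] at hα
  have hlim : ∀ k : ℕ, Tendsto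
      (fun f : ℕ => ({T | T ∈ numSets f ∧ RVal (AT T) = (k : ℤ) - 1}.ncard : ℝ) / 2 ^ (f - 1))
      atTop (𝓝 (α ((k : ℤ) - 1))) := fun k => hα _ (by omega)
  have hnonneg : ∀ k : ℕ, 0 ≤ α ((k : ℤ) - 1) := fun k =>
    ge_of_tendsto' (hlim k) fun f => by positivity
  have hsum := fun K : ℕ => tendsto_finsetSum (Finset.range (K + 1)) fun k _ => hlim k
  have hbounds : ∀ K f : ℕ, 1 ≤ f →
      1 - 8 * (3 / 4 : ℝ) ^ K ≤ ∑ k ∈ Finset.range (K + 1),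
        ({T | T ∈ numSets f ∧ RVal (AT T) = (k : ℤ) - 1}.ncard : ℝ) / 2 ^ (f - 1) ∧
      ∑ k ∈ Finset.range (K + 1),
        ({T | T ∈ numSets f ∧ RVal (AT T) = (k : ℤ) - 1}.ncard : ℝ) / 2 ^ (f - 1) ≤ 1 := by
    intro K f hf
    have htot := ncard_numSets_eq_sum_add f K
    rw [ncard_numSets hf] at htot
    have htot' := congrArg (Nat.cast (R := ℝ)) htot
    push_cast at htot'
    have htail := ncard_tail_le f K
    have hpow : (2 : ℝ) ^ f = 2 * 2 ^ (f - 1) := by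
      rw [← pow_succ', Nat.sub_add_cancel hf]
    rw [hpow] at htail
    have hpos : (0 : ℝ) < 2 ^ (f - 1) := by positivity
    rw [← Finset.sum_div, le_div_iff₀ hpos, div_le_one hpos]
    constructor
    · linarith
    · rw [htot']
      exact le_add_of_nonneg_right (Nat.cast_nonneg _)
  rw [hasSum_iff_tendsto_nat_of_nonneg hnonneg, ← tendsto_add_atTop_iff_nat 1]
  have hgeom : Tendsto (fun K : ℕ => 1 - 8 * (3 / 4 : ℝ) ^ K) atTop (𝓝 1) := by
    simpa using ((tendsto_pow_atTop_nhds_zero_of_lt_one (r := (3 / 4 : ℝ)) (by norm_num)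
      (by norm_num)).const_mul 8).const_sub 1
  refine tendsto_of_tendsto_of_tendsto_of_le_of_le hgeom tendsto_const_nhds (fun K => ?_)
    fun K => ?_
  · exact ge_of_tendsto (hsum K) ((eventually_ge_atTop 1).mono fun f hf => (hbounds K f hf).1)
  · exact le_of_tendsto (hsum K) ((eventually_ge_atTop 1).mono fun f hf => (hbounds K f hf).2)
end
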